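/- Witness bound for the Bell+R_z family: for every choice of signs ε₁, ε₂ ∈ {−1, 1}, the Hermitian operator H = ε₁·(X⊗X) + ε₂·(Y⊗X) satisfies |Tr(H·σ)| ≤ 1 for every pure two-qubit stabilizer state σ ∈ Stab₂, and the maximum value max_{σ ∈ Stab₂} Tr(H·σ) = 1 is attained. -/

import Mathlib

open Matrix Kronecker Finset
open scoped ComplexOrder

noncomputable section

def PX : Matrix (Fin 2) (Fin 2) ℂ := !![0, 1; 1, 0]
def PY : Matrix (Fin 2) (Fin 2) ℂ := !![0, -Complex.I; Complex.I, 0]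
def PZ : Matrix (Fin 2) (Fin 2) ℂ := !![1, 0; 0, -1]

/-- The single-qubit phase-point operator `A_{(q,p)}`. -/
def A1 (a : ZMod 2 × ZMod 2) : Matrix (Fin 2) (Fin 2) ℂ :=
  (1 / 2 : ℂ) • ((1 : Matrix (Fin 2) (Fin 2) ℂ)
    + ((-1 : ℂ) ^ a.2.val) • PX
    + ((-1 : ℂ) ^ (a.1.val + a.2.val)) • PY
    + ((-1 : ℂ) ^ a.1.val) • PZ)

def pauli : Fin 4 → Matrix (Fin 2) (Fin 2) ℂ := ![1, PX, PY, PZ]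

/-- A density matrix: positive semidefinite with unit trace. -/
def IsDensity {d : ℕ} (ρ : Matrix (Fin d) (Fin d) ℂ) : Prop :=
  ρ.PosSemidef ∧ ρ.trace = 1

/-- Kronecker product of 2×2 matrices as a 4×4 matrix. -/
def kron2 (M N : Matrix (Fin 2) (Fin 2) ℂ) : Matrix (Fin 4) (Fin 4) ℂ :=
  Matrix.reindex (finProdFinEquiv.trans (finCongr (by norm_num)))
    (finProdFinEquiv.trans (finCongr (by norm_num))) (M ⊗ₖ N)

/-- The two-qubit phase-point operator `A_α = A_{α₁} ⊗ A_{α₂}`. -/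
def A2 (α : (ZMod 2 × ZMod 2) × (ZMod 2 × ZMod 2)) : Matrix (Fin 4) (Fin 4) ℂ :=
  kron2 (A1 α.1) (A1 α.2)

/-- The two-qubit Pauli group `P₂`. -/
def Pauli2 : Set (Matrix (Fin 4) (Fin 4) ℂ) :=
  { M | ∃ (k : Fin 4) (P Q : Fin 4), M = Complex.I ^ (k : ℕ) • kron2 (pauli P) (pauli Q) }

/-- `S` is an abelian subgroup of `P₂` with `|S| = 4` and `-I ∉ S`. -/
def IsStabGroup2 (S : Finset (Matrix (Fin 4) (Fin 4) ℂ)) : Prop :=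
  (∀ g ∈ S, g ∈ Pauli2) ∧ (1 : Matrix (Fin 4) (Fin 4) ℂ) ∈ S ∧
  (∀ g ∈ S, ∀ h ∈ S, g * h ∈ S ∧ g * h = h * g) ∧
  S.card = 4 ∧ (-1 : Matrix (Fin 4) (Fin 4) ℂ) ∉ S

/-- The pure two-qubit stabilizer states. -/
def Stab2 : Set (Matrix (Fin 4) (Fin 4) ℂ) :=
  { σ | ∃ S : Finset (Matrix (Fin 4) (Fin 4) ℂ),
      IsStabGroup2 S ∧ σ = (4 : ℂ)⁻¹ • ∑ g ∈ S, g }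

/-- Two-qubit discrete Wigner function (of any 4×4 matrix). -/
def W2 (ρ : Matrix (Fin 4) (Fin 4) ℂ) (α : (ZMod 2 × ZMod 2) × (ZMod 2 × ZMod 2)) : ℝ :=
  ((4 : ℂ)⁻¹ * (ρ * A2 α).trace).re

/-- Two-qubit free Wigner polytope. -/
def WFree2 : Set (((ZMod 2 × ZMod 2) × (ZMod 2 × ZMod 2)) → ℝ) :=
  convexHull ℝ { w | ∃ σ ∈ Stab2, w = W2 σ }

/-- Two-qubit Wigner distance `C(ρ)`. -/
def C2 (ρ : Matrix (Fin 4) (Fin 4) ℂ) : ℝ :=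
  sInf { d | ∃ f ∈ WFree2, d = ∑ α, |W2 ρ α - f α| }

/-- Two-qubit stabilizer extent `Γ(ρ)`. -/
def Gam2 (ρ : Matrix (Fin 4) (Fin 4) ℂ) : ℝ :=
  sInf { t | ∃ (k : ℕ) (a : Fin k → ℝ) (s : Fin k → Matrix (Fin 4) (Fin 4) ℂ),
      (∀ i, s i ∈ Stab2) ∧ ρ = ∑ i, a i • s i ∧ t = ∑ i, |a i| }

/-- Rank-one projection `|ψ⟩⟨ψ|`. -/
def proj (ψ : Fin 4 → ℂ) : Matrix (Fin 4) (Fin 4) ℂ :=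
  Matrix.vecMulVec ψ fun j => (starRingEnd ℂ) (ψ j)

/-- The basis vector `|00⟩`. -/
def e0 : Fin 4 → ℂ := fun i => if i = 0 then 1 else 0

/-- The basis vector `|11⟩`. -/
def e3 : Fin 4 → ℂ := fun i => if i = 3 then 1 else 0

theorem kron2_mul (A B C D : Matrix (Fin 2) (Fin 2) ℂ) :
    kron2 A B * kron2 C D = kron2 (A * C) (B * D) := by
  simp only [kron2, reindex_apply, submatrix_mul_equiv, mul_kronecker_mul]

theorem kron2_one_one : kron2 1 1 = 1 := by
  simp [kron2]

theorem kron2_smul_left (c : ℂ) (A B : Matrix (Fin 2) (Fin 2) ℂ) :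
    kron2 (c • A) B = c • kron2 A B := by
  simp only [kron2, reindex_apply, smul_kronecker, submatrix_smul, Pi.smul_apply]

theorem trace_kron2 (A B : Matrix (Fin 2) (Fin 2) ℂ) :
    (kron2 A B).trace = A.trace * B.trace := by
  rw [← trace_kronecker, kron2, reindex_apply]
  exact Equiv.sum_comp _ (fun i => (A ⊗ₖ B) i i)

theorem PX_mul_PX : PX * PX = 1 := by
  simp [PX, one_fin_two]

theorem PY_mul_PY : PY * PY = 1 := by
  simp [PY, one_fin_two]

theorem PX_mul_PY : PX * PY = Complex.I • PZ := by
  simp [PX, PY, PZ]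

theorem PY_mul_PX : PY * PX = (-Complex.I) • PZ := by
  simp [PX, PY, PZ]

theorem PZ_mul_PZ : PZ * PZ = 1 := by
  simp [PZ, one_fin_two]

theorem trace_PX : PX.trace = 0 := by
  simp [PX, trace_fin_two]

theorem trace_PX_mul_pauli (P : Fin 4) :
    (PX * pauli P).trace = if P = 1 then 2 else 0 := by
  fin_cases P <;> simp [pauli, PX, PY, PZ, trace_fin_two]
  norm_num

theorem trace_PY_mul_pauli (P : Fin 4) :
    (PY * pauli P).trace = if P = 2 then 2 else 0 := by
  fin_cases P <;> simp [pauli, PX, PY, PZ, trace_fin_two]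
  norm_num

theorem trace_witness_mul_pauli (ε₁ ε₂ : ℝ) (c : ℂ) (P Q : Fin 4) :
    ((ε₁ • kron2 PX PX + ε₂ • kron2 PY PX) * (c • kron2 (pauli P) (pauli Q))).trace =
      4 * c * if Q = 1 then (if P = 1 then (ε₁ : ℂ) else if P = 2 then (ε₂ : ℂ) else 0)
        else 0 := by
  simp only [add_mul, smul_mul_assoc, mul_smul_comm, kron2_mul, trace_add, trace_smul,
    trace_kron2, trace_PX_mul_pauli, trace_PY_mul_pauli, Complex.real_smul, smul_eq_mul]
  by_cases hQ : Q = 1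
  · by_cases hP : P = 1
    · simp [hP, hQ]; ring
    · by_cases hP' : P = 2
      · simp [hP', hQ]; ring
      · simp [hP, hP', hQ]
  · simp [hQ]

theorem kron2_PX_PX_sq : kron2 PX PX * kron2 PX PX = 1 := by
  rw [kron2_mul, PX_mul_PX, kron2_one_one]

theorem kron2_PY_PX_sq : kron2 PY PX * kron2 PY PX = 1 := by
  rw [kron2_mul, PX_mul_PX, PY_mul_PY, kron2_one_one]

theorem norm_trace_witness_mul_le {ε₁ ε₂ : ℝ} (h₁ : ε₁ = 1 ∨ ε₁ = -1)
    (h₂ : ε₂ = 1 ∨ ε₂ = -1) {g : Matrix (Fin 4) (Fin 4) ℂ} (hg : g ∈ Pauli2) :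
    ‖((ε₁ • kron2 PX PX + ε₂ • kron2 PY PX) * g).trace‖ ≤ 4 := by
  obtain ⟨k, P, Q, rfl⟩ := hg
  rw [trace_witness_mul_pauli]
  rcases h₁ with rfl | rfl <;> rcases h₂ with rfl | rfl <;> split_ifs <;> simp

theorem eq_smul_of_trace_witness_mul_ne_zero {ε₁ ε₂ : ℝ} {g : Matrix (Fin 4) (Fin 4) ℂ}
    (hg : g ∈ Pauli2) (h : ((ε₁ • kron2 PX PX + ε₂ • kron2 PY PX) * g).trace ≠ 0) :
    ∃ c : ℂ, c ^ 4 = 1 ∧ (g = c • kron2 PX PX ∨ g = c • kron2 PY PX) := by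
  obtain ⟨k, P, Q, rfl⟩ := hg
  rw [trace_witness_mul_pauli] at h
  refine ⟨Complex.I ^ (k : ℕ), by rw [← pow_mul, mul_comm, pow_mul]; simp, ?_⟩
  split_ifs at h with hQ hP hP'
  · left; simp [hQ, hP, pauli]
  · right; simp [hQ, hP', pauli]
  · simp at h
  · simp at h

/-- Two elements of a stabilizer group proportional to the same involution are equal. -/
theorem IsStabGroup2.smul_involution_unique {S : Finset (Matrix (Fin 4) (Fin 4) ℂ)}
    (hS : IsStabGroup2 S) {U : Matrix (Fin 4) (Fin 4) ℂ} (hU : U * U = 1) {c d : ℂ}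
    (hc : c ^ 4 = 1) (hd : d ^ 4 = 1) (hcS : c • U ∈ S) (hdS : d • U ∈ S) : c = d := by
  obtain ⟨-, -, hmul, -, hneg⟩ := hS
  have key : ∀ x y : ℂ, x • U ∈ S → y • U ∈ S → x * y ≠ -1 := by
    intro x y hx hy hxy
    have := (hmul _ hx _ hy).1
    rw [smul_mul_smul_comm, hU, hxy, neg_one_smul] at this
    exact hneg this
  have sq : ∀ x : ℂ, x ^ 4 = 1 → x • U ∈ S → x * x = 1 := by
    intro x hx hxS
    have h : (x * x - 1) * (x * x - -1) = 0 := by linear_combination hx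
    rcases mul_eq_zero.1 h with h | h
    · exact sub_eq_zero.1 h
    · exact absurd (sub_eq_zero.1 h) (key x x hxS hxS)
  have hcc := sq c hc hcS
  have hdd := sq d hd hdS
  have h : (c - d) * (c + d) = 0 := by linear_combination hcc - hdd
  rcases mul_eq_zero.1 h with h | h
  · exact sub_eq_zero.1 h
  · exact absurd (by linear_combination d * h - hdd) (key c d hcS hdS)

theorem not_commute_smul_PX_PX_smul_PY_PX {c d : ℂ} (hc : c ≠ 0) (hd : d ≠ 0) :
    (c • kron2 PX PX) * (d • kron2 PY PX) ≠ (d • kron2 PY PX) * (c • kron2 PX PX) := by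
  intro h
  simp only [smul_mul_smul_comm, kron2_mul, PX_mul_PX, PX_mul_PY, PY_mul_PX,
    kron2_smul_left, smul_smul] at h
  have h' := congrArg (fun M => (M * kron2 PZ 1).trace) h
  simp only [smul_mul_assoc, kron2_mul, PZ_mul_PZ, mul_one, kron2_one_one, trace_smul,
    trace_one, Fintype.card_fin, smul_eq_mul] at h'
  have h0 : c * d * Complex.I = 0 := by
    push_cast at h'
    linear_combination h' / 8
  simp [hc, hd] at h0

theorem IsStabGroup2.eq_of_trace_witness_mul_ne_zero {ε₁ ε₂ : ℝ}
    {S : Finset (Matrix (Fin 4) (Fin 4) ℂ)} (hS : IsStabGroup2 S)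
    {g h : Matrix (Fin 4) (Fin 4) ℂ} (hg : g ∈ S) (hh : h ∈ S)
    (hg0 : ((ε₁ • kron2 PX PX + ε₂ • kron2 PY PX) * g).trace ≠ 0)
    (hh0 : ((ε₁ • kron2 PX PX + ε₂ • kron2 PY PX) * h).trace ≠ 0) : g = h := by
  obtain ⟨c, hc, hgc⟩ := eq_smul_of_trace_witness_mul_ne_zero (hS.1 g hg) hg0
  obtain ⟨d, hd, hhd⟩ := eq_smul_of_trace_witness_mul_ne_zero (hS.1 h hh) hh0
  have hc0 : c ≠ 0 := by rintro rfl; norm_num at hc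
  have hd0 : d ≠ 0 := by rintro rfl; norm_num at hd
  have hcomm := (hS.2.2.1 g hg h hh).2
  rcases hgc with rfl | rfl <;> rcases hhd with rfl | rfl
  · rw [hS.smul_involution_unique kron2_PX_PX_sq hc hd hg hh]
  · exact absurd hcomm (not_commute_smul_PX_PX_smul_PY_PX hc0 hd0)
  · exact absurd hcomm.symm (not_commute_smul_PX_PX_smul_PY_PX hd0 hc0)
  · rw [hS.smul_involution_unique kron2_PY_PX_sq hc hd hg hh]

theorem norm_trace_witness_mul_stab_le {ε₁ ε₂ : ℝ} (h₁ : ε₁ = 1 ∨ ε₁ = -1)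
    (h₂ : ε₂ = 1 ∨ ε₂ = -1) {σ : Matrix (Fin 4) (Fin 4) ℂ} (hσ : σ ∈ Stab2) :
    ‖((ε₁ • kron2 PX PX + ε₂ • kron2 PY PX) * σ).trace‖ ≤ 1 := by
  obtain ⟨S, hS, rfl⟩ := hσ
  rw [mul_smul_comm, trace_smul, Finset.mul_sum, trace_sum, norm_smul]
  suffices h : ‖∑ g ∈ S, ((ε₁ • kron2 PX PX + ε₂ • kron2 PY PX) * g).trace‖ ≤ 4 by
    rw [norm_inv, Complex.norm_ofNat]
    linarith
  by_cases hex : ∃ g ∈ S, ((ε₁ • kron2 PX PX + ε₂ • kron2 PY PX) * g).trace ≠ 0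
  · obtain ⟨g, hg, hg0⟩ := hex
    rw [Finset.sum_eq_single_of_mem g hg fun h hh hne => by
      by_contra hh0
      exact hne (hS.eq_of_trace_witness_mul_ne_zero hh hg hh0 hg0)]
    exact norm_trace_witness_mul_le h₁ h₂ (hS.1 g hg)
  · push Not at hex
    rw [Finset.sum_eq_zero hex]
    simp

open Classical in
/-- Two commuting traceless Pauli involutions with traceless product generate a stabilizer
group, whose stabilizer state is the normalised sum of its elements. -/
theorem stab2_of_involutions {a b : Matrix (Fin 4) (Fin 4) ℂ} (ha : a ∈ Pauli2)
    (hb : b ∈ Pauli2) (hab : a * b ∈ Pauli2) (haa : a * a = 1) (hbb : b * b = 1)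
    (hcomm : b * a = a * b) (ta : a.trace = 0) (tb : b.trace = 0) (tab : (a * b).trace = 0) :
    (4 : ℂ)⁻¹ • (1 + a + b + a * b) ∈ Stab2 := by
  have t1 : (1 : Matrix (Fin 4) (Fin 4) ℂ).trace = 4 := by simp
  have tn : (-1 : Matrix (Fin 4) (Fin 4) ℂ).trace = -4 := by simp
  have ne_of_trace : ∀ {M N : Matrix (Fin 4) (Fin 4) ℂ}, M.trace ≠ N.trace → M ≠ N :=
    fun h e => h (congrArg trace e)
  have h1a : 1 ≠ a := ne_of_trace (by rw [t1, ta]; norm_num)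
  have h1b : 1 ≠ b := ne_of_trace (by rw [t1, tb]; norm_num)
  have h1ab : 1 ≠ a * b := ne_of_trace (by rw [t1, tab]; norm_num)
  have hne : a ≠ b := by
    rintro rfl
    exact h1ab haa.symm
  have haab : a * (a * b) = b := by rw [← mul_assoc, haa, one_mul]
  have habb : a * b * b = a := by rw [mul_assoc, hbb, mul_one]
  have hbab : b * (a * b) = a := by rw [← mul_assoc, hcomm, habb]
  have haba : a * b * a = b := by rw [mul_assoc, hcomm, haab]
  have habab : a * b * (a * b) = 1 := by rw [mul_assoc, hbab, haa]
  have ha_ne : a ≠ a * b := fun h => h1b (by rw [← haa, ← haab, ← h])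
  have hb_ne : b ≠ a * b := fun h => h1a (by rw [← hbb, ← habb, ← h])
  refine ⟨{1, a, b, a * b}, ⟨?_, by simp, ?_, ?_, ?_⟩, ?_⟩
  · intro g hg
    simp only [Finset.mem_insert, Finset.mem_singleton] at hg
    rcases hg with rfl | rfl | rfl | rfl
    · exact ⟨0, 0, 0, by simp [pauli, kron2_one_one]⟩
    all_goals assumption
  · intro g hg h hh
    simp only [Finset.mem_insert, Finset.mem_singleton] at hg hh ⊢
    rcases hg with rfl | rfl | rfl | rfl <;> rcases hh with rfl | rfl | rfl | rfl <;>
      simp only [one_mul, mul_one, haa, hbb, hcomm, haab, habb, hbab, haba, habab,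
        true_or, or_true, and_self]
  · rw [Finset.card_insert_of_notMem (by simp [h1a, h1b, h1ab]),
      Finset.card_insert_of_notMem (by simp [hne, ha_ne]), Finset.card_pair hb_ne]
  · simp only [Finset.mem_insert, Finset.mem_singleton, not_or]
    refine ⟨ne_of_trace ?_, ne_of_trace ?_, ne_of_trace ?_, ne_of_trace ?_⟩ <;>
      simp only [tn, t1, ta, tb, tab] <;> norm_num
  · rw [Finset.sum_insert (by simp [h1a, h1b, h1ab]), Finset.sum_insert (by simp [hne, ha_ne]),
      Finset.sum_pair hb_ne, add_assoc, add_assoc]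

theorem exists_stab2_trace_witness_mul_eq_one {ε₁ : ℝ} (ε₂ : ℝ) (h₁ : ε₁ = 1 ∨ ε₁ = -1) :
    ∃ σ ∈ Stab2, ((ε₁ • kron2 PX PX + ε₂ • kron2 PY PX) * σ).trace = 1 := by
  have hsq : (ε₁ : ℂ) * ε₁ = 1 := by rcases h₁ with rfl | rfl <;> simp
  obtain ⟨k, hk⟩ : ∃ k : Fin 4, (ε₁ : ℂ) = Complex.I ^ (k : ℕ) := by
    rcases h₁ with rfl | rfl
    · exact ⟨0, by simp⟩
    · exact ⟨2, by simp⟩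
  have hmul : kron2 PX 1 * ((ε₁ : ℂ) • kron2 1 PX) = (ε₁ : ℂ) • kron2 PX PX := by
    rw [mul_smul_comm, kron2_mul, one_mul, mul_one]
  refine ⟨_, stab2_of_involutions (a := kron2 PX 1) (b := (ε₁ : ℂ) • kron2 1 PX)
    ⟨0, 1, 0, by simp [pauli]⟩ ⟨k, 0, 1, by simp [pauli, hk]⟩
    ⟨k, 1, 1, by simp [pauli, hk, kron2_mul]⟩ ?_ ?_ ?_ ?_ ?_ ?_, ?_⟩
  · rw [kron2_mul, PX_mul_PX, one_mul, kron2_one_one]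
  · rw [smul_mul_smul_comm, hsq, kron2_mul, PX_mul_PX, one_mul, kron2_one_one, one_smul]
  · rw [hmul, smul_mul_assoc, kron2_mul, one_mul, mul_one]
  · rw [trace_kron2, trace_PX, zero_mul]
  · rw [trace_smul, trace_kron2, trace_PX, mul_zero, smul_zero]
  · rw [hmul, trace_smul, trace_kron2, trace_PX, mul_zero, smul_zero]
  · rw [hmul]
    have e1 := trace_witness_mul_pauli ε₁ ε₂ 1 0 0
    have e2 := trace_witness_mul_pauli ε₁ ε₂ 1 1 0
    have e3 := trace_witness_mul_pauli ε₁ ε₂ ε₁ 0 1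
    have e4 := trace_witness_mul_pauli ε₁ ε₂ ε₁ 1 1
    simp only [pauli, cons_val_zero, cons_val_one, kron2_one_one, one_smul] at e1 e2 e3 e4
    rw [mul_smul_comm, mul_add, mul_add, mul_add, trace_smul, trace_add, trace_add, trace_add,
      e1, e2, e3, e4]
    simp [mul_assoc, hsq]

/-- witness bound for the Bell+R_z family: for any signs
`ε₁, ε₂ ∈ {−1,1}`, `H = ε₁·X⊗X + ε₂·Y⊗X` has `|Tr(Hσ)| ≤ 1` on all
stabilizer states, with maximum value 1 attained. -/
theorem witness_BellRz (ε₁ ε₂ : ℝ) (h₁ : ε₁ = 1 ∨ ε₁ = -1) (h₂ : ε₂ = 1 ∨ ε₂ = -1) :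
    (∀ σ ∈ Stab2, ‖((ε₁ • kron2 PX PX + ε₂ • kron2 PY PX) * σ).trace‖ ≤ 1) ∧
    IsGreatest
      { v | ∃ σ ∈ Stab2, v = (((ε₁ • kron2 PX PX + ε₂ • kron2 PY PX) * σ).trace).re } 1 := by
  refine ⟨fun σ hσ => norm_trace_witness_mul_stab_le h₁ h₂ hσ, ?_, ?_⟩
  · obtain ⟨σ, hσ, h⟩ := exists_stab2_trace_witness_mul_eq_one ε₂ h₁
    exact ⟨σ, hσ, by rw [h, Complex.one_re]⟩
  · rintro v ⟨σ, hσ, rfl⟩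
    exact (Complex.re_le_norm _).trans (norm_trace_witness_mul_stab_le h₁ h₂ hσ)
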